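/- Let σ₂ be the linear involution of ℂ⁸ sending (Y₀,Y₁,Y₂,Y₃,X₀,X₁,X₂,X₃) to (Y₀,−Y₁,−Y₂,Y₃,X₀,−X₁,−X₂,X₃). The set of fixed points of σ₂ on 𝒳, i.e. the set of complex lines ℂ·p with p ∈ C𝒳 nonzero and σ₂(p) ∈ ℂ·p, has exactly 16 elements, and every such p is a singular point of C𝒳. -/

import Mathlib

/-- The defining polynomials `F₀, F₁, F₂, F₃` in the variables
`Y₀,Y₁,Y₂,Y₃,X₀,X₁,X₂,X₃` (variable `i` for `i < 4` is `Yᵢ`, variable `4+i`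
is `Xᵢ`). -/
noncomputable def vgnF : Fin 4 → MvPolynomial (Fin 8) ℂ
  | 0 => MvPolynomial.X 0 ^ 2 -
      (MvPolynomial.X 4 ^ 2 + MvPolynomial.X 5 ^ 2 + MvPolynomial.X 6 ^ 2 + MvPolynomial.X 7 ^ 2)
  | 1 => MvPolynomial.X 1 ^ 2 -
      (MvPolynomial.X 4 ^ 2 - MvPolynomial.X 5 ^ 2 + MvPolynomial.X 6 ^ 2 - MvPolynomial.X 7 ^ 2)
  | 2 => MvPolynomial.X 2 ^ 2 -
      (MvPolynomial.X 4 ^ 2 + MvPolynomial.X 5 ^ 2 - MvPolynomial.X 6 ^ 2 - MvPolynomial.X 7 ^ 2)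
  | 3 => MvPolynomial.X 3 ^ 2 -
      (MvPolynomial.X 4 ^ 2 - MvPolynomial.X 5 ^ 2 - MvPolynomial.X 6 ^ 2 + MvPolynomial.X 7 ^ 2)

/-- The affine cone `C𝒳 ⊆ ℂ⁸`: the common zero set of `F₀, F₁, F₂, F₃`. -/
def coneX : Set (Fin 8 → ℂ) :=
  {p | ∀ i : Fin 4, MvPolynomial.eval p (vgnF i) = 0}

/-- The Jacobian matrix of `(F₀,F₁,F₂,F₃)` at a point `p`. -/
noncomputable def vgnJacobian (p : Fin 8 → ℂ) : Matrix (Fin 4) (Fin 8) ℂ :=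
  Matrix.of fun i j => MvPolynomial.eval p (MvPolynomial.pderiv j (vgnF i))

/-- A nonzero point `p ∈ C𝒳` is a singular point if the Jacobian matrix of
`(F₀,F₁,F₂,F₃)` at `p` has rank `< 4`. -/
def IsSingPt (p : Fin 8 → ℂ) : Prop :=
  p ≠ 0 ∧ p ∈ coneX ∧ (vgnJacobian p).rank < 4

/-- The involution `σ₂ : (Y₀,Y₁,Y₂,Y₃,X₀,X₁,X₂,X₃) ↦
`(Y₀,−Y₁,−Y₂,Y₃,X₀,−X₁,−X₂,X₃)`. -/
def sigma2 (p : Fin 8 → ℂ) : Fin 8 → ℂ :=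
  ![p 0, -p 1, -p 2, p 3, p 4, -p 5, -p 6, p 7]

/-- The sign attached to a Boolean. -/
def sgnB (b : Bool) : ℂ := if b then 1 else -1

lemma sgnB_inj {a b : Bool} (h : sgnB a = sgnB b) : a = b := by
  cases a <;> cases b <;> first | rfl | (exfalso; norm_num [sgnB] at h)

lemma sgnB_sq (b : Bool) : sgnB b ^ 2 = 1 := by
  cases b <;> norm_num [sgnB]

lemma exists_sgnB {x y : ℂ} (h : x ^ 2 = y ^ 2) : ∃ b, x = sgnB b * y := by
  rcases sq_eq_sq_iff_eq_or_eq_neg.mp h with h | h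
  · exact ⟨true, by simp [sgnB, h]⟩
  · exact ⟨false, by simp [sgnB, h]⟩

/-- A square root of two. -/
noncomputable def rt : ℂ := ((Real.sqrt 2 : ℝ) : ℂ)

lemma rt_sq : rt ^ 2 = 2 := by
  unfold rt
  rw [← Complex.ofReal_pow, Real.sq_sqrt (by norm_num)]
  norm_num

lemma rt_ne : rt ≠ 0 := by
  intro h
  have := rt_sq
  rw [h] at this
  norm_num at this

/-- Representatives of the sixteen fixed lines. -/
noncomputable def repP : Bool × Bool × Bool × Bool → Fin 8 → ℂ
  | (true, a, b, c) => ![sgnB a * rt, 0, 0, sgnB b * rt, 1, 0, 0, sgnB c]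
  | (false, a, b, c) =>
      ![0, sgnB a * (Complex.I * rt), sgnB b * rt, 0, 0, 1, sgnB c * Complex.I, 0]

lemma mem_coneX (p : Fin 8 → ℂ) : p ∈ coneX ↔
    (p 0 ^ 2 = p 4 ^ 2 + p 5 ^ 2 + p 6 ^ 2 + p 7 ^ 2 ∧
     p 1 ^ 2 = p 4 ^ 2 - p 5 ^ 2 + p 6 ^ 2 - p 7 ^ 2 ∧
     p 2 ^ 2 = p 4 ^ 2 + p 5 ^ 2 - p 6 ^ 2 - p 7 ^ 2 ∧
     p 3 ^ 2 = p 4 ^ 2 - p 5 ^ 2 - p 6 ^ 2 + p 7 ^ 2) := by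
  simp [coneX, Fin.forall_fin_succ, vgnF, sub_eq_zero]

lemma fixed_cases (p : Fin 8 → ℂ) (hp : p ≠ 0) (h : ∃ c : ℂ, sigma2 p = c • p) :
    (p 1 = 0 ∧ p 2 = 0 ∧ p 5 = 0 ∧ p 6 = 0) ∨ (p 0 = 0 ∧ p 3 = 0 ∧ p 4 = 0 ∧ p 7 = 0) := by
  obtain ⟨c, hc⟩ := h
  have e : ∀ i, sigma2 p i = c * p i := fun i => by rw [hc]; rfl
  have e0 : p 0 = c * p 0 := e 0
  have e1 : -p 1 = c * p 1 := e 1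
  have e2 : -p 2 = c * p 2 := e 2
  have e3 : p 3 = c * p 3 := e 3
  have e4 : p 4 = c * p 4 := e 4
  have e5 : -p 5 = c * p 5 := e 5
  have e6 : -p 6 = c * p 6 := e 6
  have e7 : p 7 = c * p 7 := e 7
  by_cases h1 : c = 1
  · left
    subst h1
    refine ⟨?_, ?_, ?_, ?_⟩ <;> grind
  · right
    have h1' : c - 1 ≠ 0 := sub_ne_zero.mpr h1
    have key : ∀ x : ℂ, x = c * x → x = 0 := fun x hx => by
      have : (c - 1) * x = 0 := by linear_combination -hx
      exact (mul_eq_zero.mp this).resolve_left h1'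
    exact ⟨key _ e0, key _ e3, key _ e4, key _ e7⟩

lemma repP_ne (t : Bool × Bool × Bool × Bool) : repP t ≠ 0 := by
  obtain ⟨k, a, b, c⟩ := t
  intro h
  cases k
  · have := congrFun h 5
    simp [repP] at this
  · have := congrFun h 4
    simp [repP] at this

lemma repP_mem (t : Bool × Bool × Bool × Bool) : repP t ∈ coneX := by
  obtain ⟨k, a, b, c⟩ := t
  rw [mem_coneX]
  cases k <;> simp [repP, mul_pow, sgnB_sq, rt_sq] <;> norm_num

lemma repP_fixed (t : Bool × Bool × Bool × Bool) : ∃ c : ℂ, sigma2 (repP t) = c • repP t := by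
  obtain ⟨k, a, b, c⟩ := t
  cases k
  · refine ⟨-1, ?_⟩
    ext i
    fin_cases i <;> simp [sigma2, repP]
  · refine ⟨1, ?_⟩
    ext i
    fin_cases i <;> simp [sigma2, repP]

lemma repP_inj : Function.Injective (fun t => Submodule.span ℂ {repP t}) := by
  rintro ⟨k, a, b, c⟩ ⟨k', a', b', c'⟩ h
  have hm : repP (k, a, b, c) ∈ Submodule.span ℂ {repP (k', a', b', c')} := by
    rw [← show Submodule.span ℂ {repP (k, a, b, c)} = Submodule.span ℂ {repP (k', a', b', c')} from h]
    exact Submodule.mem_span_singleton_self _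
  obtain ⟨z, hz⟩ := Submodule.mem_span_singleton.mp hm
  have e : ∀ i, z * repP (k', a', b', c') i = repP (k, a, b, c) i := fun i => by
    rw [← hz]; rfl
  have e4 := e 4
  have e5 := e 5
  cases k <;> cases k'
  · have hz1 : z = 1 := by simpa [repP] using e5
    subst hz1
    have ha := e 1
    have hb := e 2
    have hc := e 6
    simp [repP, rt_ne] at ha hb hc
    rw [sgnB_inj ha, sgnB_inj hb, sgnB_inj hc]
  · simp [repP] at e5
  · simp [repP] at e4
  · have hz1 : z = 1 := by simpa [repP] using e4
    subst hz1
    have ha := e 0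
    have hb := e 3
    have hc := e 7
    simp [repP, rt_ne] at ha hb hc
    rw [sgnB_inj ha, sgnB_inj hb, sgnB_inj hc]

lemma exists_rep (p : Fin 8 → ℂ) (hp : p ≠ 0) (hX : p ∈ coneX)
    (h : ∃ c : ℂ, sigma2 p = c • p) : ∃ t, ∃ z : ℂ, z ≠ 0 ∧ p = z • repP t := by
  obtain ⟨f0, f1, f2, f3⟩ := (mem_coneX p).mp hX
  rcases fixed_cases p hp h with ⟨h1, h2, h5, h6⟩ | ⟨h0, h3, h4, h7⟩
  · simp only [h1, h2, h5, h6] at f0 f1 f2 f3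
    have g7 : p 7 ^ 2 = p 4 ^ 2 := by linear_combination f1
    obtain ⟨c, hc⟩ := exists_sgnB g7
    obtain ⟨a, ha⟩ := exists_sgnB (x := p 0) (y := rt * p 4)
      (by linear_combination f0 + g7 - p 4 ^ 2 * rt_sq)
    obtain ⟨b, hb⟩ := exists_sgnB (x := p 3) (y := rt * p 4)
      (by linear_combination f3 + g7 - p 4 ^ 2 * rt_sq)
    refine ⟨(true, a, b, c), p 4, ?_, ?_⟩
    · intro h4
      apply hp
      ext i
      fin_cases i <;> simp [*]
    · ext i
      fin_cases i <;> simp [repP, h1, h2, h5, h6] <;> first | linear_combination ha | linear_combination hb | linear_combination hc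
  · simp only [h0, h3, h4, h7] at f0 f1 f2 f3
    have g6 : p 6 ^ 2 = (Complex.I * p 5) ^ 2 := by
      linear_combination -f0 - p 5 ^ 2 * Complex.I_sq
    have g6' : p 6 ^ 2 = - p 5 ^ 2 := by linear_combination -f0
    obtain ⟨c, hc⟩ := exists_sgnB g6
    obtain ⟨a, ha⟩ := exists_sgnB (x := p 1) (y := Complex.I * rt * p 5)
      (by rw [mul_pow, mul_pow, Complex.I_sq, rt_sq]; linear_combination f1 + g6')
    obtain ⟨b, hb⟩ := exists_sgnB (x := p 2) (y := rt * p 5)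
      (by linear_combination f2 - g6' - p 5 ^ 2 * rt_sq)
    refine ⟨(false, a, b, c), p 5, ?_, ?_⟩
    · intro h5
      apply hp
      ext i
      fin_cases i <;> simp [*]
    · ext i
      fin_cases i <;> simp [repP, h0, h3, h4, h7] <;> first | linear_combination ha | linear_combination hb | linear_combination hc

lemma rank_lt (M : Matrix (Fin 4) (Fin 8) ℂ) (g : Fin 4 → ℂ) (hg : g ≠ 0)
    (h : ∀ j, ∑ i, g i * M i j = 0) : M.rank < 4 := by
  refine lt_of_le_of_ne (by simpa using M.rank_le_card_height) fun h4 => ?_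
  rw [Matrix.rank_eq_finrank_span_row] at h4
  have hli : LinearIndependent ℂ M.row := by
    rw [linearIndependent_iff_card_eq_finrank_span]
    simpa [Set.finrank] using h4.symm
  apply hg
  ext i
  refine Fintype.linearIndependent_iff.mp hli g ?_ i
  ext j
  simpa using h j

lemma sing (p : Fin 8 → ℂ) (hp : p ≠ 0) (hX : p ∈ coneX)
    (h : ∃ c : ℂ, sigma2 p = c • p) : IsSingPt p := by
  refine ⟨hp, hX, ?_⟩
  rcases fixed_cases p hp h with ⟨h1, h2, h5, h6⟩ | ⟨h0, h3, h4, h7⟩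
  · refine rank_lt _ ![0, 1, -1, 0] (fun h => by simpa using congrFun h 1) fun j => ?_
    fin_cases j <;>
      simp [Fin.sum_univ_four, vgnJacobian, vgnF, MvPolynomial.pderiv_X, Pi.single_apply, *]
  · refine rank_lt _ ![1, 0, 0, 1] (fun h => by simpa using congrFun h 0) fun j => ?_
    fin_cases j <;>
      simp [Fin.sum_univ_four, vgnJacobian, vgnF, MvPolynomial.pderiv_X, Pi.single_apply, *]

lemma set_eq : {L : Submodule ℂ (Fin 8 → ℂ) | ∃ p, p ≠ 0 ∧ p ∈ coneX ∧
        (∃ c : ℂ, sigma2 p = c • p) ∧ L = Submodule.span ℂ {p}} =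
    Set.range (fun t => Submodule.span ℂ {repP t}) := by
  ext L
  constructor
  · rintro ⟨p, hp, hX, h, rfl⟩
    obtain ⟨t, z, hz, rfl⟩ := exists_rep p hp hX h
    exact ⟨t, (Submodule.span_singleton_smul_eq (IsUnit.mk0 z hz) _).symm⟩
  · rintro ⟨t, rfl⟩
    exact ⟨repP t, repP_ne t, repP_mem t, repP_fixed t, rfl⟩

/-- The set of fixed points of `σ₂` on `𝒳` — the set of complex lines `ℂ·p`
with `p ∈ C𝒳` nonzero and `σ₂(p) ∈ ℂ·p` — has exactly `16` elements, and
every such `p` is a singular point of `C𝒳`. -/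
theorem sigma2_fixed_points :
    {L : Submodule ℂ (Fin 8 → ℂ) | ∃ p, p ≠ 0 ∧ p ∈ coneX ∧
        (∃ c : ℂ, sigma2 p = c • p) ∧ L = Submodule.span ℂ {p}}.Finite ∧
    {L : Submodule ℂ (Fin 8 → ℂ) | ∃ p, p ≠ 0 ∧ p ∈ coneX ∧
        (∃ c : ℂ, sigma2 p = c • p) ∧ L = Submodule.span ℂ {p}}.ncard = 16 ∧
    ∀ p : Fin 8 → ℂ, p ≠ 0 → p ∈ coneX → (∃ c : ℂ, sigma2 p = c • p) →
      IsSingPt p := by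
  rw [set_eq]
  refine ⟨Set.finite_range _, ?_, sing⟩
  rw [← Set.image_univ, Set.ncard_image_of_injective _ repP_inj, Set.ncard_univ]
  simp
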